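/- arXiv:2407.15196 — 3 statements merged into one kernel-verified Lean document; each statement's English description precedes it below -/
import Mathlib

section
/- Let k = rank(H_F), let P ∈ ℂ^{N_T×N_T} be the matrix of the orthogonal projection of ℂ^{N_T} onto the kernel of H_F, and set Y = H_D·P·H_Dᴴ. Then for every unitary matrix Θ ∈ ℂ^{N_S×N_S}, the equivalent channel H = H_D + H_B·Θ·H_F satisfies: σ_n(H)² ≤ λ_{n−k}(Y) for every n with k < n ≤ N_R, and σ_n(H)² ≥ λ_n(Y) for every n with 1 ≤ n ≤ N_R. -/
open Matrix

noncomputable def nthLargest {m : ℕ} (f : Fin m → ℝ) (n : ℕ) : ℝ :=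
  if h : 1 ≤ n ∧ n ≤ m then (f ∘ Tuple.sort f) ⟨m - n, by omega⟩ else 0

noncomputable def nthEig {m : ℕ} (Y : Matrix (Fin m) (Fin m) ℂ) (hY : Y.IsHermitian) (n : ℕ) : ℝ :=
  nthLargest hY.eigenvalues n

/-- The `n`-th largest singular value (1-based) of a complex matrix, equal to the square root
of the `n`-th largest eigenvalue of `A * Aᴴ`, with the convention that it is `0` whenever
`n` exceeds the matrix dimensions. -/
noncomputable def singVal {r c : ℕ} (A : Matrix (Fin r) (Fin c) ℂ) (n : ℕ) : ℝ :=
  Real.sqrt (nthLargest (Matrix.isHermitian_mul_conjTranspose_self A).eigenvalues n)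



theorem quad_eq {m : ℕ} {A : Matrix (Fin m) (Fin m) ℂ} (hA : A.IsHermitian) (x : Fin m → ℂ) :
    (star x ⬝ᵥ (A *ᵥ x)).re =
      ∑ i, hA.eigenvalues i *
        Complex.normSq (((hA.eigenvectorUnitary : Matrix (Fin m) (Fin m) ℂ)ᴴ *ᵥ x) i) := by
  set U : Matrix (Fin m) (Fin m) ℂ := (hA.eigenvectorUnitary : Matrix (Fin m) (Fin m) ℂ) with hU
  have hs : A = U * diagonal (fun i => (hA.eigenvalues i : ℂ)) * Uᴴ := by
    have := hA.spectral_theorem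
    rw [Unitary.conjStarAlgAut_apply] at this
    exact this
  have h1 : star x ⬝ᵥ (A *ᵥ x) =
      star (Uᴴ *ᵥ x) ⬝ᵥ (diagonal (fun i => (hA.eigenvalues i : ℂ)) *ᵥ (Uᴴ *ᵥ x)) := by
    conv_lhs => rw [hs]
    rw [star_mulVec, conjTranspose_conjTranspose, ← dotProduct_mulVec, mulVec_mulVec,
      mulVec_mulVec]
  rw [h1, dotProduct, Complex.re_sum]
  refine Finset.sum_congr rfl fun i _ => ?_
  rw [mulVec_diagonal]
  simp [Complex.normSq_apply]
  ring

theorem normSq_sum {m : ℕ} {A : Matrix (Fin m) (Fin m) ℂ} (hA : A.IsHermitian) (x : Fin m → ℂ) :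
    ∑ i, Complex.normSq (((hA.eigenvectorUnitary : Matrix (Fin m) (Fin m) ℂ)ᴴ *ᵥ x) i)
      = ∑ i, Complex.normSq (x i) := by
  set U : Matrix (Fin m) (Fin m) ℂ := (hA.eigenvectorUnitary : Matrix (Fin m) (Fin m) ℂ) with hU
  have hs : U * Uᴴ = 1 := Unitary.coe_mul_star_self hA.eigenvectorUnitary
  have key : ∀ y : Fin m → ℂ, (star y ⬝ᵥ y).re = ∑ i, Complex.normSq (y i) := by
    intro y
    rw [dotProduct, Complex.re_sum]
    refine Finset.sum_congr rfl fun i _ => ?_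
    simp [Complex.normSq_apply]
  rw [← key, ← key, star_mulVec, conjTranspose_conjTranspose, ← dotProduct_mulVec, mulVec_mulVec,
    hs, one_mulVec]

theorem weyl_aux {m p : ℕ} {A B : Matrix (Fin m) (Fin m) ℂ} (hA : A.IsHermitian)
    (hB : B.IsHermitian) (L : Matrix (Fin p) (Fin m) ℂ) (k n : ℕ) (hL : L.rank ≤ k)
    (hAB : ∀ x, L *ᵥ x = 0 → (star x ⬝ᵥ (A *ᵥ x)).re ≤ (star x ⬝ᵥ (B *ᵥ x)).re)
    (hkn : k < n) (hn : n ≤ m) :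
    nthLargest hA.eigenvalues n ≤ nthLargest hB.eigenvalues (n - k) := by
  set UA : Matrix (Fin m) (Fin m) ℂ := (hA.eigenvectorUnitary : Matrix (Fin m) (Fin m) ℂ) with hUA
  set UB : Matrix (Fin m) (Fin m) ℂ := (hB.eigenvectorUnitary : Matrix (Fin m) (Fin m) ℂ) with hUB
  set f := hA.eigenvalues with hf
  set g := hB.eigenvalues with hg
  set s := Tuple.sort f
  set t := Tuple.sort g
  let S := {j : Fin m // j < (⟨m - n, by omega⟩ : Fin m)}
  let T := {j : Fin m // (⟨m - (n - k), by omega⟩ : Fin m) < j}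
  have hS : Fintype.card S = m - n := by
    rw [Fintype.card_subtype, Finset.filter_gt_eq_Iio, Fin.card_Iio]
  have hT : Fintype.card T = n - k - 1 := by
    rw [Fintype.card_subtype, Finset.filter_lt_eq_Ioi, Fin.card_Ioi]
    change m - 1 - (m - (n - k)) = _
    omega
  let Φ : (Fin m → ℂ) →ₗ[ℂ] (LinearMap.range L.mulVecLin) × (S → ℂ) × (T → ℂ) :=
    (L.mulVecLin.rangeRestrict).prod
      ((LinearMap.pi fun j : S => (LinearMap.proj (s j.1)) ∘ₗ UAᴴ.mulVecLin).prod
       (LinearMap.pi fun j : T => (LinearMap.proj (t j.1)) ∘ₗ UBᴴ.mulVecLin))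
  have hker : LinearMap.ker Φ ≠ ⊥ := by
    apply LinearMap.ker_ne_bot_of_finrank_lt
    rw [Module.finrank_prod, Module.finrank_prod, Module.finrank_fintype_fun_eq_card,
      Module.finrank_fintype_fun_eq_card, Module.finrank_fintype_fun_eq_card, hS, hT,
      Fintype.card_fin]
    change L.rank + _ < m
    omega
  obtain ⟨x, hx, hx0⟩ := Submodule.exists_mem_ne_zero_of_ne_bot hker
  have hΦ : Φ x = 0 := hx
  have hxL : L *ᵥ x = 0 := by
    have := congrArg (fun z => (z.1 : Fin p → ℂ)) hΦ
    simpa [Φ] using this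
  have hxS : ∀ j : S, (UAᴴ *ᵥ x) (s j.1) = 0 := fun j => by
    have := congrArg (fun z => z.2.1 j) hΦ
    simpa [Φ] using this
  have hxT : ∀ j : T, (UBᴴ *ᵥ x) (t j.1) = 0 := fun j => by
    have := congrArg (fun z => z.2.2 j) hΦ
    simpa [Φ] using this
  have hpos : 0 < ∑ i, Complex.normSq (x i) := by
    obtain ⟨i, hi⟩ := Function.ne_iff.mp hx0
    exact Finset.sum_pos' (fun i _ => Complex.normSq_nonneg _)
      ⟨i, Finset.mem_univ _, Complex.normSq_pos.mpr hi⟩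
  have ha : nthLargest f n * ∑ i, Complex.normSq (x i) ≤ (star x ⬝ᵥ (A *ᵥ x)).re := by
    rw [quad_eq hA, ← normSq_sum hA, Finset.mul_sum]
    refine Finset.sum_le_sum fun i _ => ?_
    obtain ⟨j, rfl⟩ := s.surjective i
    by_cases hj : j < (⟨m - n, by omega⟩ : Fin m)
    · have := hxS ⟨j, hj⟩
      simp only [] at this
      rw [← hUA, this]; simp
    · refine mul_le_mul_of_nonneg_right ?_ (Complex.normSq_nonneg _)
      rw [nthLargest, dif_pos (by omega)]
      exact Tuple.monotone_sort f (not_lt.mp hj)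
  have hb : (star x ⬝ᵥ (B *ᵥ x)).re ≤ nthLargest g (n - k) * ∑ i, Complex.normSq (x i) := by
    rw [quad_eq hB, ← normSq_sum hB, Finset.mul_sum]
    refine Finset.sum_le_sum fun i _ => ?_
    obtain ⟨j, rfl⟩ := t.surjective i
    by_cases hj : (⟨m - (n - k), by omega⟩ : Fin m) < j
    · have := hxT ⟨j, hj⟩
      simp only [] at this
      rw [← hUB, this]; simp
    · refine mul_le_mul_of_nonneg_right ?_ (Complex.normSq_nonneg _)
      rw [nthLargest, dif_pos (by omega)]
      exact Tuple.monotone_sort g (not_lt.mp hj)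
  exact le_of_mul_le_mul_right (ha.trans ((hAB x hxL).trans hb)) hpos

open scoped ComplexOrder in
theorem singVal_sq {r c : ℕ} (A : Matrix (Fin r) (Fin c) ℂ) (n : ℕ) :
    singVal A n ^ 2 = nthLargest (Matrix.isHermitian_mul_conjTranspose_self A).eigenvalues n := by
  rw [singVal, Real.sq_sqrt]
  rw [nthLargest]
  split_ifs
  · exact (Matrix.posSemidef_self_mul_conjTranspose A).eigenvalues_nonneg _
  · exact le_rfl

theorem stmt4 {N_T N_R N_S : ℕ}
    (H_D : Matrix (Fin N_R) (Fin N_T) ℂ)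
    (H_B : Matrix (Fin N_R) (Fin N_S) ℂ)
    (H_F : Matrix (Fin N_S) (Fin N_T) ℂ)
    (k : ℕ) (hk : k = H_F.rank)
    -- `P` is the matrix of the orthogonal projection of `ℂ^{N_T}` onto `ker H_F`:
    (P : Matrix (Fin N_T) (Fin N_T) ℂ)
    (hP_herm : P.IsHermitian) (hP_idem : P * P = P)
    (hP_range : H_F * P = 0)
    (hP_ker : ∀ x : Fin N_T → ℂ, H_F.mulVec x = 0 → P.mulVec x = x)
    (hY : (H_D * P * H_Dᴴ).IsHermitian)
    (Θ : Matrix (Fin N_S) (Fin N_S) ℂ) (hΘ : Θᴴ * Θ = 1) :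
    (∀ n : ℕ, k < n → n ≤ N_R →
      (singVal (H_D + H_B * Θ * H_F) n) ^ 2 ≤ nthEig (H_D * P * H_Dᴴ) hY (n - k)) ∧
    (∀ n : ℕ, 1 ≤ n → n ≤ N_R →
      nthEig (H_D * P * H_Dᴴ) hY n ≤ (singVal (H_D + H_B * Θ * H_F) n) ^ 2) := by
  set H := H_D + H_B * Θ * H_F with hH
  have hHP : H * P = H_D * P := by
    rw [hH, Matrix.add_mul, Matrix.mul_assoc (H_B * Θ), hP_range, Matrix.mul_zero, add_zero]
  have hPH : P * Hᴴ = P * H_Dᴴ := by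
    have := congrArg conjTranspose hHP
    rwa [conjTranspose_mul, conjTranspose_mul, hP_herm.eq] at this
  have hYe : H_D * P * H_Dᴴ = H * P * Hᴴ := by
    rw [hHP, ← hP_idem, ← Matrix.mul_assoc, Matrix.mul_assoc (H_D * P), Matrix.mul_assoc (H_D * P),
      hPH]
  have hQ : (1 - P) * (1 - P) = 1 - P := by
    rw [Matrix.mul_sub, Matrix.sub_mul, Matrix.sub_mul, hP_idem]; simp
  have hQh : (1 - P)ᴴ = 1 - P := by simp [hP_herm.eq]
  set L := (1 - P) * Hᴴ with hL
  have hsum : H * Hᴴ = H_D * P * H_Dᴴ + Lᴴ * L := by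
    have : Lᴴ * L = H * (1 - P) * Hᴴ := by
      rw [hL, conjTranspose_mul, conjTranspose_conjTranspose, hQh, Matrix.mul_assoc,
        ← Matrix.mul_assoc (1 - P), hQ, Matrix.mul_assoc]
    rw [this, hYe, ← Matrix.add_mul, ← Matrix.mul_add]
    simp
  have hquad : ∀ x, (star x ⬝ᵥ ((H * Hᴴ) *ᵥ x)) =
      (star x ⬝ᵥ ((H_D * P * H_Dᴴ) *ᵥ x)) + star (L *ᵥ x) ⬝ᵥ (L *ᵥ x) := by
    intro x
    rw [hsum, add_mulVec, dotProduct_add, star_mulVec, ← dotProduct_mulVec, mulVec_mulVec]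
  have hrank : L.rank ≤ k := by
    have h1 : L.rank ≤ (1 - P).rank := Matrix.rank_mul_le_left _ _
    have h2 : (1 - P).rank ≤ H_F.rank := by
      have e1 := LinearMap.finrank_range_add_finrank_ker (1 - P).mulVecLin
      have e2 := LinearMap.finrank_range_add_finrank_ker H_F.mulVecLin
      have h3 : LinearMap.ker H_F.mulVecLin ≤ LinearMap.ker (1 - P).mulVecLin := by
        intro x hx
        rw [LinearMap.mem_ker, mulVecLin_apply] at hx ⊢
        rw [sub_mulVec, one_mulVec, hP_ker x hx, sub_self]
      have h4 := Submodule.finrank_mono h3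
      unfold Matrix.rank
      omega
    omega
  constructor
  · intro n hkn hn
    rw [singVal_sq, nthEig]
    refine weyl_aux _ hY L k n hrank (fun x hx => ?_) hkn hn
    rw [hquad, hx]; simp
  · intro n h1 hn
    rw [singVal_sq, nthEig]
    have := weyl_aux hY (Matrix.isHermitian_mul_conjTranspose_self H)
      (0 : Matrix (Fin 0) (Fin N_R) ℂ) 0 n (by simp) (fun x _ => ?_) h1 hn
    · simpa using this
    rw [hquad, Complex.add_re]
    have : 0 ≤ (star (L *ᵥ x) ⬝ᵥ (L *ᵥ x)).re := by
      rw [dotProduct, Complex.re_sum]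
      refine Finset.sum_nonneg fun i _ => ?_
      have := Complex.normSq_nonneg ((L *ᵥ x) i)
      simpa [Complex.normSq_apply] using this
    linarith
end

section
/- Suppose rank(H_F) ≤ 1 (line-of-sight forward channel). Let P ∈ ℂ^{N_T×N_T} be the matrix of the orthogonal projection of ℂ^{N_T} onto the kernel of H_F and set Y = H_D·P·H_Dᴴ. Then for every unitary matrix Θ ∈ ℂ^{N_S×N_S}, the equivalent channel H = H_D + H_B·Θ·H_F satisfies the interlacing: for every n ≥ 1, σ_{n+1}(H)² ≤ λ_n(Y) ≤ σ_n(H)². -/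
open Matrix

lemma aux_card_lt {m : ℕ} (f : Fin m → ℝ) (n : ℕ) (h1 : 1 ≤ n) (h2 : n ≤ m) :
    Fintype.card {i // f i < nthLargest f n} ≤ m - n := by
  have hlt : ∀ i : {i // f i < nthLargest f n}, ((Tuple.sort f).symm i.1 : ℕ) < m - n := by
    rintro ⟨i, hi⟩
    by_contra hc
    have hm := Tuple.monotone_sort f
      (show (⟨m - n, by omega⟩ : Fin m) ≤ (Tuple.sort f).symm i from by
        rw [Fin.le_def]; simpa using hc)
    rw [nthLargest, dif_pos ⟨h1, h2⟩] at hi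
    simp only [Function.comp_apply, Equiv.apply_symm_apply] at hm hi
    linarith
  have := Fintype.card_le_of_injective
    (fun i : {i // f i < nthLargest f n} => (⟨_, hlt i⟩ : Fin (m - n))) (by
      intro a b hab
      simp only [Fin.mk.injEq] at hab
      exact Subtype.ext ((Tuple.sort f).symm.injective (Fin.ext hab)))
  simpa using this

lemma aux_card_gt {m : ℕ} (f : Fin m → ℝ) (n : ℕ) (h1 : 1 ≤ n) (h2 : n ≤ m) :
    Fintype.card {i // nthLargest f n < f i} ≤ n - 1 := by
  have hlt : ∀ i : {i // nthLargest f n < f i},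
      ((Tuple.sort f).symm i.1 : ℕ) - (m - n + 1) < n - 1 ∧
        m - n < ((Tuple.sort f).symm i.1 : ℕ) := by
    rintro ⟨i, hi⟩
    have h : m - n < ((Tuple.sort f).symm i : ℕ) := by
      by_contra hc
      have hm := Tuple.monotone_sort f
        (show (Tuple.sort f).symm i ≤ (⟨m - n, by omega⟩ : Fin m) from by
          rw [Fin.le_def]; simpa using hc)
      rw [nthLargest, dif_pos ⟨h1, h2⟩] at hi
      simp only [Function.comp_apply, Equiv.apply_symm_apply] at hm hi
      linarith
    have := ((Tuple.sort f).symm i).2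
    exact ⟨by simp only; omega, h⟩
  have := Fintype.card_le_of_injective
    (fun i : {i // nthLargest f n < f i} => (⟨_, (hlt i).1⟩ : Fin (n - 1))) (by
      intro a b hab
      simp only [Fin.mk.injEq] at hab
      have ha := (hlt a).2
      have hb := (hlt b).2
      exact Subtype.ext ((Tuple.sort f).symm.injective (Fin.ext (by omega))))
  simpa using this

lemma aux_norm {m : ℕ} (x : Fin m → ℂ) : (star x ⬝ᵥ x).re = ∑ i, Complex.normSq (x i) := by
  simp [dotProduct, Complex.normSq_apply]

lemma aux_quad {m : ℕ} (A : Matrix (Fin m) (Fin m) ℂ) (hA : A.IsHermitian) (x : Fin m → ℂ) :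
    (star x ⬝ᵥ (A *ᵥ x)).re = ∑ i, hA.eigenvalues i *
      Complex.normSq ((star (hA.eigenvectorUnitary : Matrix (Fin m) (Fin m) ℂ) *ᵥ x) i) := by
  set U := (hA.eigenvectorUnitary : Matrix (Fin m) (Fin m) ℂ) with hU
  have h : A = U * diagonal (RCLike.ofReal ∘ hA.eigenvalues) * star U := by
    conv_lhs => rw [hA.spectral_theorem, Unitary.conjStarAlgAut_apply]
  have e : star x ⬝ᵥ (A *ᵥ x) =
      star (star U *ᵥ x) ⬝ᵥ (diagonal (RCLike.ofReal ∘ hA.eigenvalues) *ᵥ (star U *ᵥ x)) := by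
    conv_lhs => rw [h]
    rw [star_mulVec, ← dotProduct_mulVec, star_eq_conjTranspose, conjTranspose_conjTranspose,
      mulVec_mulVec, mulVec_mulVec]
  rw [e]
  simp only [dotProduct, mulVec_diagonal, Complex.re_sum]
  refine Finset.sum_congr rfl fun i _ => ?_
  simp [Complex.normSq_apply]
  ring

lemma aux_norm_U {m : ℕ} (A : Matrix (Fin m) (Fin m) ℂ) (hA : A.IsHermitian) (x : Fin m → ℂ) :
    ∑ i, Complex.normSq ((star (hA.eigenvectorUnitary : Matrix (Fin m) (Fin m) ℂ) *ᵥ x) i)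
      = ∑ i, Complex.normSq (x i) := by
  rw [← aux_norm, ← aux_norm, star_mulVec, ← dotProduct_mulVec, star_eq_conjTranspose,
    conjTranspose_conjTranspose, mulVec_mulVec, ← star_eq_conjTranspose,
    Unitary.mul_star_self_of_mem hA.eigenvectorUnitary.2, one_mulVec]

lemma aux_interlace {m : ℕ} (A B : Matrix (Fin m) (Fin m) ℂ) (hA : A.IsHermitian)
    (hB : B.IsHermitian) {p k : ℕ} (L : Matrix (Fin p) (Fin m) ℂ) (hL : L.rank ≤ k)
    (hle : ∀ x : Fin m → ℂ, L *ᵥ x = 0 → (star x ⬝ᵥ (A *ᵥ x)).re ≤ (star x ⬝ᵥ (B *ᵥ x)).re)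
    (n : ℕ) (hn : 1 ≤ n) (hnk : n + k ≤ m) :
    nthLargest hA.eigenvalues (n + k) ≤ nthLargest hB.eigenvalues n := by
  set a := nthLargest hA.eigenvalues (n + k) with ha
  set b := nthLargest hB.eigenvalues n with hb
  have ca : Fintype.card {i // hA.eigenvalues i < a} ≤ m - (n + k) :=
    aux_card_lt _ _ (by omega) hnk
  have cb : Fintype.card {i // b < hB.eigenvalues i} ≤ n - 1 :=
    aux_card_gt _ _ hn (by omega)
  let UA := star (hA.eigenvectorUnitary : Matrix (Fin m) (Fin m) ℂ)
  let UB := star (hB.eigenvectorUnitary : Matrix (Fin m) (Fin m) ℂ)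
  let fA : (Fin m → ℂ) →ₗ[ℂ] ({i // hA.eigenvalues i < a} → ℂ) :=
    (LinearMap.funLeft ℂ ℂ Subtype.val) ∘ₗ UA.mulVecLin
  let fB : (Fin m → ℂ) →ₗ[ℂ] ({i // b < hB.eigenvalues i} → ℂ) :=
    (LinearMap.funLeft ℂ ℂ Subtype.val) ∘ₗ UB.mulVecLin
  let F := fA.prod (fB.prod L.mulVecLin.rangeRestrict)
  have hk : LinearMap.ker F ≠ ⊥ := by
    apply LinearMap.ker_ne_bot_of_finrank_lt
    have : Module.finrank ℂ L.mulVecLin.range ≤ k := hL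
    simp only [Module.finrank_prod, Module.finrank_fintype_fun_eq_card, Fintype.card_fin]
    omega
  obtain ⟨x, hx, hx0⟩ := Submodule.exists_mem_ne_zero_of_ne_bot hk
  have hx' : fA x = 0 ∧ fB x = 0 ∧ L *ᵥ x = 0 := by
    simpa [F] using hx
  obtain ⟨h1, h2, h3'⟩ := hx'
  have key := hle x h3'
  rw [aux_quad A hA, aux_quad B hB] at key
  have lo : a * ∑ i, Complex.normSq (x i) ≤ ∑ i, hA.eigenvalues i *
      Complex.normSq ((star (hA.eigenvectorUnitary : Matrix (Fin m) (Fin m) ℂ) *ᵥ x) i) := by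
    rw [← aux_norm_U A hA, Finset.mul_sum]
    refine Finset.sum_le_sum fun i _ => ?_
    by_cases hi : hA.eigenvalues i < a
    · have : (UA *ᵥ x) i = 0 := congrFun h1 ⟨i, hi⟩
      change a * Complex.normSq ((UA *ᵥ x) i) ≤ _ * Complex.normSq ((UA *ᵥ x) i)
      simp [this]
    · exact mul_le_mul_of_nonneg_right (not_lt.mp hi) (Complex.normSq_nonneg _)
  have up : ∑ i, hB.eigenvalues i *
      Complex.normSq ((star (hB.eigenvectorUnitary : Matrix (Fin m) (Fin m) ℂ) *ᵥ x) i)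
      ≤ b * ∑ i, Complex.normSq (x i) := by
    rw [← aux_norm_U B hB, Finset.mul_sum]
    refine Finset.sum_le_sum fun i _ => ?_
    by_cases hi : b < hB.eigenvalues i
    · have : (UB *ᵥ x) i = 0 := congrFun h2 ⟨i, hi⟩
      change _ * Complex.normSq ((UB *ᵥ x) i) ≤ b * Complex.normSq ((UB *ᵥ x) i)
      simp [this]
    · exact mul_le_mul_of_nonneg_right (not_lt.mp hi) (Complex.normSq_nonneg _)
  have pos : 0 < ∑ i, Complex.normSq (x i) := by
    obtain ⟨i, hi⟩ := Function.ne_iff.mp hx0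
    exact Finset.sum_pos' (fun i _ => Complex.normSq_nonneg _)
      ⟨i, Finset.mem_univ _, Complex.normSq_pos.mpr hi⟩
  exact le_of_mul_le_mul_right (lo.trans (key.trans up)) pos

open scoped ComplexOrder in
lemma aux_eig_nonneg {m p : ℕ} (M : Matrix (Fin m) (Fin p) ℂ) (h : (M * Mᴴ).IsHermitian) :
    ∀ i, 0 ≤ h.eigenvalues i :=
  (posSemidef_self_mul_conjTranspose M).eigenvalues_nonneg

lemma aux_nonneg {m : ℕ} (f : Fin m → ℝ) (hf : ∀ i, 0 ≤ f i) (n : ℕ) : 0 ≤ nthLargest f n := by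
  unfold nthLargest
  split_ifs
  · exact hf _
  · exact le_rfl

theorem stmt5 {N_T N_R N_S : ℕ}
    (H_D : Matrix (Fin N_R) (Fin N_T) ℂ)
    (H_B : Matrix (Fin N_R) (Fin N_S) ℂ)
    (H_F : Matrix (Fin N_S) (Fin N_T) ℂ)
    (hLoS : H_F.rank ≤ 1)
    -- `P` is the matrix of the orthogonal projection of `ℂ^{N_T}` onto `ker H_F`:
    (P : Matrix (Fin N_T) (Fin N_T) ℂ)
    (hP_herm : P.IsHermitian) (hP_idem : P * P = P)
    (hP_range : H_F * P = 0)
    (hP_ker : ∀ x : Fin N_T → ℂ, H_F.mulVec x = 0 → P.mulVec x = x)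
    (hY : (H_D * P * H_Dᴴ).IsHermitian)
    (Θ : Matrix (Fin N_S) (Fin N_S) ℂ) (hΘ : Θᴴ * Θ = 1) :
    ∀ n : ℕ, 1 ≤ n →
      (singVal (H_D + H_B * Θ * H_F) (n + 1)) ^ 2 ≤ nthEig (H_D * P * H_Dᴴ) hY n ∧
      nthEig (H_D * P * H_Dᴴ) hY n ≤ (singVal (H_D + H_B * Θ * H_F) n) ^ 2 := by
  have hHP : (H_D + H_B * Θ * H_F) * P = H_D * P := by
    rw [Matrix.add_mul, Matrix.mul_assoc _ H_F P, hP_range, Matrix.mul_zero, add_zero]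
  generalize H_D + H_B * Θ * H_F = H at hHP
  have hY2 : H_D * P * H_Dᴴ = (H * P) * (H * P)ᴴ := by
    rw [hHP, conjTranspose_mul, hP_herm.eq, Matrix.mul_assoc H_D P (P * H_Dᴴ),
      ← Matrix.mul_assoc P P, hP_idem, Matrix.mul_assoc]
  generalize H_D * P * H_Dᴴ = Y at hY hY2
  have hYe : ∀ i, 0 ≤ hY.eigenvalues i := by
    subst hY2
    exact aux_eig_nonneg (H * P) hY
  have hHe := aux_eig_nonneg H (Matrix.isHermitian_mul_conjTranspose_self H)
  -- the difference of the two quadratic forms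
  set L : Matrix (Fin N_T) (Fin N_R) ℂ := (1 - P) * Hᴴ with hL
  have hQ : H * Hᴴ = Y + Lᴴ * L := by
    rw [hY2, hL, conjTranspose_mul, conjTranspose_mul, conjTranspose_sub, hP_herm.eq,
      conjTranspose_one, conjTranspose_conjTranspose]
    have e1 : H * P * (P * Hᴴ) = H * P * Hᴴ := by
      rw [Matrix.mul_assoc H P (P * Hᴴ), ← Matrix.mul_assoc P P, hP_idem, Matrix.mul_assoc]
    have e2 : H * (1 - P) * ((1 - P) * Hᴴ) = H * (1 - P) * Hᴴ := by
      have : (1 - P) * (1 - P) = 1 - P := by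
        rw [mul_sub, sub_mul, sub_mul, hP_idem]; simp
      rw [Matrix.mul_assoc H (1 - P) ((1 - P) * Hᴴ), ← Matrix.mul_assoc (1 - P) (1 - P), this,
        Matrix.mul_assoc]
    rw [e1, e2, ← Matrix.add_mul, ← Matrix.mul_add]
    simp
  have hform : ∀ x : Fin N_R → ℂ, (star x ⬝ᵥ ((H * Hᴴ) *ᵥ x)).re =
      (star x ⬝ᵥ (Y *ᵥ x)).re + ∑ i, Complex.normSq ((L *ᵥ x) i) := by
    intro x
    rw [hQ, add_mulVec, dotProduct_add, Complex.add_re, ← mulVec_mulVec, dotProduct_mulVec _ Lᴴ,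
      ← star_mulVec, aux_norm]
  have hrk : L.rank ≤ 1 := by
    refine (rank_mul_le_left _ _).trans (le_trans ?_ hLoS)
    have hker : LinearMap.ker H_F.mulVecLin ≤ LinearMap.ker (1 - P).mulVecLin := by
      intro x hx
      simp only [LinearMap.mem_ker, mulVecLin_apply] at hx ⊢
      rw [sub_mulVec, one_mulVec, hP_ker x hx, sub_self]
    have a1 := Submodule.finrank_mono hker
    have a2 := H_F.mulVecLin.finrank_range_add_finrank_ker
    have a3 := (1 - P).mulVecLin.finrank_range_add_finrank_ker
    unfold Matrix.rank
    omega
  intro n hn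
  unfold singVal nthEig
  rw [Real.sq_sqrt (aux_nonneg _ hHe _), Real.sq_sqrt (aux_nonneg _ hHe _)]
  constructor
  · by_cases h : n + 1 ≤ N_R
    · refine aux_interlace _ _ _ hY L hrk ?_ n hn h
      intro x hx
      rw [hform x, hx]
      simp
    · have : nthLargest (Matrix.isHermitian_mul_conjTranspose_self H).eigenvalues (n + 1) = 0 := by
        rw [nthLargest, dif_neg (by omega)]
      rw [this]
      exact aux_nonneg _ hYe _
  · by_cases h : n ≤ N_R
    · refine aux_interlace _ _ hY _ (k := 0) (0 : Matrix (Fin 1) (Fin N_R) ℂ) (by simp) ?_ n hn h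
      intro x _
      rw [hform x]
      have : 0 ≤ ∑ i, Complex.normSq ((L *ᵥ x) i) :=
        Finset.sum_nonneg fun i _ => Complex.normSq_nonneg _
      linarith
    · rw [nthLargest, nthLargest, dif_neg (by omega), dif_neg (by omega)]
end

section
/- For every unitary matrix Θ ∈ ℂ^{N_S×N_S}, the product of the N_S largest singular values of H_B·Θ·H_F equals the product of the corresponding pairwise products of singular values of the factors: ∏_{n=1}^{N_S} σ_n(H_B·Θ·H_F) = ∏_{n=1}^{N_S} σ_n(H_B)·σ_n(H_F). -/
open Matrix

open scoped ComplexOrder in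
theorem aux_nn {r c : ℕ} (A : Matrix (Fin r) (Fin c) ℂ) (i : Fin r) :
    0 ≤ (Matrix.isHermitian_mul_conjTranspose_self A).eigenvalues i :=
  (Matrix.posSemidef_self_mul_conjTranspose A).eigenvalues_nonneg i

theorem aux_prod_nthLargest {k s : ℕ} (f : Fin (k + s) → ℝ) (g : ℝ → ℝ) :
    ∏ n ∈ Finset.Icc 1 s, g (nthLargest f n) =
      ∏ i : Fin s, g (f (Tuple.sort f (Fin.natAdd k i))) := by
  have h1 : ∏ n ∈ Finset.Icc 1 s, g (nthLargest f n) =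
      ∏ n ∈ Finset.range s, g (nthLargest f (n + 1)) := by
    rw [Finset.range_eq_Ico, Finset.prod_Ico_add' (fun n => g (nthLargest f n)) 0 s 1]
    rfl
  rw [h1, ← Fin.prod_univ_eq_prod_range (fun n => g (nthLargest f (n + 1))) s,
    ← Equiv.prod_comp Fin.revPerm (fun i : Fin s => g (f (Tuple.sort f (Fin.natAdd k i))))]
  refine Finset.prod_congr rfl fun i _ => ?_
  have hi := i.2
  have h : 1 ≤ (i : ℕ) + 1 ∧ (i : ℕ) + 1 ≤ k + s := by omega
  unfold nthLargest
  rw [dif_pos h]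
  simp only [Function.comp]
  have he : (⟨k + s - ((i : ℕ) + 1), by omega⟩ : Fin (k + s)) =
      Fin.natAdd k (Fin.revPerm i) := by
    ext
    simp [Fin.rev]
    omega
  rw [he]

theorem aux_key {r s t : ℕ} (B : Matrix (Fin r) (Fin s) ℂ) (C : Matrix (Fin s) (Fin t) ℂ)
    (A : Matrix (Fin r) (Fin t) ℂ) (hA : A = B * C) :
    (((∏ n ∈ Finset.Icc 1 s, singVal A n) ^ 2 : ℝ) : ℂ) = (Bᴴ * B).det * (C * Cᴴ).det := by
  rcases lt_or_ge r s with hrs | hrs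
  · have h1 : ∏ n ∈ Finset.Icc 1 s, singVal A n = 0 := by
      apply Finset.prod_eq_zero (i := s)
      · simp; omega
      · unfold singVal nthLargest
        rw [dif_neg (by omega)]; simp
    have h2 : (Bᴴ * B).det = 0 := by
      by_contra h
      have hu : IsUnit (Bᴴ * B) := (Matrix.isUnit_iff_isUnit_det _).2 (isUnit_iff_ne_zero.2 h)
      have h3 := Matrix.rank_of_isUnit _ hu
      have h4 := Matrix.rank_mul_le_right Bᴴ B
      have h5 := Matrix.rank_le_height B
      simp at h3
      omega
    rw [h1, h2]; simp
  · obtain ⟨k, rfl⟩ := Nat.exists_eq_add_of_le' hrs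
    set hH := Matrix.isHermitian_mul_conjTranspose_self A with hHdef
    set f := hH.eigenvalues with hf
    have hnn : ∀ i, 0 ≤ f i := aux_nn A
    set μ : Fin (k + s) → ℝ := fun i => f (Tuple.sort f i) with hμ
    have hmono : Monotone μ := Tuple.monotone_sort f
    have hrank : (A * Aᴴ).rank ≤ s := by
      rw [hA, Matrix.mul_assoc B C]
      exact (Matrix.rank_mul_le_left _ _).trans (Matrix.rank_le_width B)
    have hz : ∀ j : Fin k, μ (Fin.castAdd s j) = 0 := by
      intro j
      by_contra hj
      have hpos : 0 < μ (Fin.castAdd s j) := lt_of_le_of_ne (hnn _) (Ne.symm hj)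
      have hc := hH.rank_eq_card_non_zero_eigs
      have : s + 1 ≤ Fintype.card {i // hH.eigenvalues i ≠ 0} := by
        let φ : Option (Fin s) → {i // hH.eigenvalues i ≠ 0} := fun o =>
          match o with
          | none => ⟨Tuple.sort f (Fin.castAdd s j), hj⟩
          | some i => ⟨Tuple.sort f (Fin.natAdd k i), (lt_of_lt_of_le hpos (hmono (by
              rw [Fin.le_def]; simp; omega))).ne'⟩
        have hφ : Function.Injective φ := by
          rintro (_ | a) (_ | b) hab
          · rfl
          · have := (Tuple.sort f).injective (Subtype.ext_iff.1 hab)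
            simp [Fin.ext_iff] at this; omega
          · have := (Tuple.sort f).injective (Subtype.ext_iff.1 hab)
            simp [Fin.ext_iff] at this; omega
          · have := (Tuple.sort f).injective (Subtype.ext_iff.1 hab)
            simp [Fin.ext_iff] at this
            rw [Fin.ext this]
        simpa using Fintype.card_le_of_injective φ hφ
      omega
    have hcp : (A * Aᴴ).charpoly = ∏ i, (Polynomial.X - Polynomial.C ((μ i : ℝ) : ℂ)) := by
      rw [hH.charpoly_eq]
      exact (Equiv.prod_comp (Tuple.sort f)
        (fun i => Polynomial.X - Polynomial.C ((f i : ℝ) : ℂ))).symm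
    have hcp2 : (A * Aᴴ).charpoly = Polynomial.X ^ k * (C * Cᴴ * (Bᴴ * B)).charpoly := by
      have h := Matrix.charpoly_mul_comm' B (C * Cᴴ * Bᴴ)
      have e1 : A * Aᴴ = B * (C * Cᴴ * Bᴴ) := by
        rw [hA, Matrix.conjTranspose_mul]; simp only [Matrix.mul_assoc]
      have e2 : C * Cᴴ * (Bᴴ * B) = C * Cᴴ * Bᴴ * B := by simp only [Matrix.mul_assoc]
      rw [e1, e2]
      simp only [Fintype.card_fin] at h
      rw [pow_add, mul_comm (Polynomial.X ^ k), mul_assoc] at h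
      exact mul_left_cancel₀ (pow_ne_zero _ Polynomial.X_ne_zero) h
    rw [hcp, Fin.prod_univ_add] at hcp2
    simp only [hz, Complex.ofReal_zero, map_zero, sub_zero, Finset.prod_const, Finset.card_univ,
      Fintype.card_fin] at hcp2
    have h3 := mul_left_cancel₀ (pow_ne_zero _ Polynomial.X_ne_zero) hcp2
    have h4 := congrArg (Polynomial.eval 0) h3
    have h5 := Matrix.det_eq_sign_charpoly_coeff (C * Cᴴ * (Bᴴ * B))
    rw [Polynomial.coeff_zero_eq_eval_zero, ← h4, Polynomial.eval_prod] at h5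
    simp only [Polynomial.eval_sub, Polynomial.eval_X, Polynomial.eval_C, zero_sub,
      Finset.prod_neg, Finset.card_univ, Fintype.card_fin, ← mul_assoc, ← mul_pow] at h5
    simp only [neg_mul_neg, mul_one, one_pow, one_mul, Matrix.det_mul] at h5
    have h6 : (∏ n ∈ Finset.Icc 1 s, singVal A n) ^ 2 = ∏ i : Fin s, μ (Fin.natAdd k i) := by
      have := aux_prod_nthLargest f Real.sqrt
      unfold singVal
      rw [this, ← Finset.prod_pow]
      exact Finset.prod_congr rfl fun i _ => Real.sq_sqrt (hnn _)
    rw [h6, Complex.ofReal_prod, ← h5]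
    ring

theorem stmt9 {N_R N_S N_T : ℕ}
    (H_B : Matrix (Fin N_R) (Fin N_S) ℂ) (H_F : Matrix (Fin N_S) (Fin N_T) ℂ)
    (Θ : Matrix (Fin N_S) (Fin N_S) ℂ) (hΘ : Θᴴ * Θ = 1) :
    ∏ n ∈ Finset.Icc 1 N_S, singVal (H_B * Θ * H_F) n =
      ∏ n ∈ Finset.Icc 1 N_S, singVal H_B n * singVal H_F n := by
  have hnn : ∀ {r c : ℕ} (A : Matrix (Fin r) (Fin c) ℂ),
      0 ≤ ∏ n ∈ Finset.Icc 1 N_S, singVal A n :=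
    fun A => Finset.prod_nonneg fun n _ => Real.sqrt_nonneg _
  rw [Finset.prod_mul_distrib]
  rw [← sq_eq_sq₀ (hnn _) (mul_nonneg (hnn _) (hnn _)), mul_pow]
  have h1 := aux_key (H_B * Θ) H_F _ rfl
  have h2 := aux_key H_B 1 H_B (by simp)
  have h3 := aux_key 1 H_F H_F (by simp)
  have hd : Θᴴ.det * Θ.det = 1 := by rw [← Matrix.det_mul, hΘ, Matrix.det_one]
  have h4 : ((H_B * Θ)ᴴ * (H_B * Θ)).det = (H_Bᴴ * H_B).det := by
    have : (H_B * Θ)ᴴ * (H_B * Θ) = Θᴴ * (H_Bᴴ * H_B) * Θ := by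
      rw [Matrix.conjTranspose_mul]; simp only [Matrix.mul_assoc]
    rw [this, Matrix.det_mul, Matrix.det_mul]
    linear_combination (H_Bᴴ * H_B).det * hd
  apply Complex.ofReal_injective
  rw [Complex.ofReal_mul, h1, h2, h3, h4]
  simp
end
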